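/- arXiv:2302.12715 — 4 statements merged into one kernel-verified Lean document; each statement's English description precedes it below -/
import Mathlib

section
/- Let A ∈ ℝ^{d×p}, let k be a positive integer, and let y ∈ ℝ^d. Suppose ẑ* ∈ ℝ^p is a minimizer of ‖y − A ẑ‖² over all k-sparse ẑ ∈ ℝ^p, and z̃ ∈ ℝ^p is a minimizer of ‖(y − A ẑ*) − A ẑ‖² over all k-sparse ẑ ∈ ℝ^p. Then the minimum of ‖y − A ẑ‖² over all 2k-sparse ẑ ∈ ℝ^p satisfies: min over 2k-sparse ẑ of ‖y − A ẑ‖² ≤ ‖y − A ẑ*‖² − ‖A z̃‖². -/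
noncomputable section

/-- A vector is `k`-sparse if it has at most `k` nonzero entries. -/
def IsKSparse {ι : Type*} [Fintype ι] (k : ℕ) (x : ι → ℝ) : Prop :=
  (Finset.univ.filter fun i => x i ≠ 0).card ≤ k

/-- Squared Euclidean norm. -/
def sqNorm {ι : Type*} [Fintype ι] (v : ι → ℝ) : ℝ := ∑ i, (v i) ^ 2

/-- Two rounds of optimal `k`-sparse approximation improve on one round:
`min_{2k-sparse ẑ} ‖y - A ẑ‖² ≤ ‖y - A ẑ*‖² - ‖A z̃‖²`. -/
theorem two_round_sparse_approximation (d p k : ℕ) (hk : 0 < k)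
    (A : Matrix (Fin d) (Fin p) ℝ) (y : Fin d → ℝ)
    (zstar ztilde : Fin p → ℝ)
    (hzstar_sparse : IsKSparse k zstar)
    (hzstar_opt : ∀ w : Fin p → ℝ, IsKSparse k w →
      sqNorm (y - A.mulVec zstar) ≤ sqNorm (y - A.mulVec w))
    (hztilde_sparse : IsKSparse k ztilde)
    (hztilde_opt : ∀ w : Fin p → ℝ, IsKSparse k w →
      sqNorm ((y - A.mulVec zstar) - A.mulVec ztilde) ≤
        sqNorm ((y - A.mulVec zstar) - A.mulVec w)) :
    (⨅ zh : {v : Fin p → ℝ // IsKSparse (2 * k) v}, sqNorm (y - A.mulVec zh.1)) ≤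
      sqNorm (y - A.mulVec zstar) - sqNorm (A.mulVec ztilde) := by
  have hs : ∀ t : ℝ, IsKSparse k (t • ztilde) := by
    intro t
    refine le_trans (Finset.card_le_card ?_) hztilde_sparse
    intro i hi
    simp only [Finset.mem_filter, Finset.mem_univ, true_and, Pi.smul_apply, smul_eq_mul] at hi ⊢
    exact right_ne_zero_of_mul hi
  have hsum : IsKSparse (2 * k) (zstar + ztilde) := by
    unfold IsKSparse at *
    have h : (Finset.univ.filter fun i => (zstar + ztilde) i ≠ 0) ⊆
        (Finset.univ.filter fun i => zstar i ≠ 0) ∪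
          (Finset.univ.filter fun i => ztilde i ≠ 0) := by
      intro i hi
      simp only [Finset.mem_filter, Finset.mem_univ, true_and, Pi.add_apply,
        Finset.mem_union] at hi ⊢
      by_contra! hc
      exact hi (by rw [hc.1, hc.2, add_zero])
    have h1 := Finset.card_le_card h
    have h2 := Finset.card_union_le (Finset.univ.filter fun i => zstar i ≠ 0)
      (Finset.univ.filter fun i => ztilde i ≠ 0)
    omega
  have hbdd : BddBelow (Set.range fun zh : {v : Fin p → ℝ // IsKSparse (2 * k) v} =>
      sqNorm (y - A.mulVec zh.1)) := by
    refine ⟨0, ?_⟩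
    rintro _ ⟨z, rfl⟩
    exact Finset.sum_nonneg fun i _ => sq_nonneg _
  refine (ciInf_le hbdd ⟨zstar + ztilde, hsum⟩).trans ?_
  simp only [Matrix.mulVec_add, ← sub_sub]
  have hopt := fun t : ℝ => hztilde_opt _ (hs t)
  simp only [Matrix.mulVec_smul] at hopt
  generalize y - A.mulVec zstar = r at *
  generalize A.mulVec ztilde = b at *
  have hexp : ∀ t : ℝ, sqNorm (r - t • b) =
      sqNorm r - 2 * t * (∑ i, r i * b i) + t ^ 2 * sqNorm b := by
    intro t
    simp only [sqNorm, Finset.mul_sum, ← Finset.sum_sub_distrib, ← Finset.sum_add_distrib]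
    refine Finset.sum_congr rfl fun i _ => ?_
    simp only [Pi.sub_apply, Pi.smul_apply, smul_eq_mul]
    ring
  have h1 := hexp 1
  rw [one_smul] at h1
  have hB : 0 ≤ sqNorm b := Finset.sum_nonneg fun i _ => sq_nonneg _
  simp only [hexp] at hopt
  rw [h1] at hopt ⊢
  generalize (∑ i, r i * b i) = c at *
  generalize sqNorm b = B at *
  suffices B ≤ c by linarith
  rcases hB.eq_or_lt with h0 | h0
  · have := hopt 0
    subst h0
    linarith
  · have := hopt (c / B)
    have e : 2 * (c / B) * c - (c / B) ^ 2 * B = c ^ 2 / B := by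
      field_simp
      ring
    have h2 : c ^ 2 / B ≤ 2 * c - B := by linarith
    rw [div_le_iff₀ h0] at h2
    nlinarith [sq_nonneg (c - B)]

end
end

section
/- There exists a universal constant C > 0 such that the following holds. Let A ∈ ℝ^{d×p} satisfy the (2k, δ)-restricted isometry property with δ ≤ 1/2 for some positive integer k, and let ρ > 0 and η ∈ (0, ρ]. Then there exists a matrix B ∈ ℝ^{d×q} with q ≤ C·p²·(1 + ρ/η)² columns such that for every 2k-sparse z ∈ ℝ^p with ‖A z‖ ≤ ρ, there exists a k-sparse ẑ ∈ ℝ^q with ‖A z − B ẑ‖ ≤ k·η. -/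
noncomputable section

/-- `(s, δ)`-restricted isometry property. -/
def SatisfiesRIP {d p : ℕ} (A : Matrix (Fin d) (Fin p) ℝ) (s : ℕ) (δ : ℝ) : Prop :=
  ∀ x : Fin p → ℝ, IsKSparse s x →
    (1 - δ) * sqNorm x ≤ sqNorm (A.mulVec x) ∧ sqNorm (A.mulVec x) ≤ (1 + δ) * sqNorm x

theorem aux_pair {ι P V : Type*} [Fintype ι] [DecidableEq P] [AddCommGroup V] [Module ℝ V]
    (g : ι → V) (h : P → V) (h1 : ∀ i, ∃ c, g c = h i) (h2 : ∀ i j, ∃ c, g c = h i + h j)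
    (k : ℕ) : ∀ S : Finset P, S.card ≤ 2 * k →
      ∃ zh : ι → ℝ, IsKSparse k zh ∧ ∑ c, zh c • g c = ∑ i ∈ S, h i := by
  classical
  have step : ∀ (k : ℕ) (zh : ι → ℝ) (c : ι), IsKSparse k zh →
      IsKSparse (k + 1) (zh + Pi.single c 1) := by
    intro k zh c hz
    unfold IsKSparse at *
    have : (Finset.univ.filter fun i => (zh + Pi.single c (1:ℝ) : ι → ℝ) i ≠ 0) ⊆
        insert c (Finset.univ.filter fun i => zh i ≠ 0) := by
      intro i hi
      by_cases hic : i = c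
      · simp [hic]
      · simp [hic] at hi ⊢
        exact hi
    exact (Finset.card_le_card this).trans ((Finset.card_insert_le _ _).trans (by omega))
  have stepsum : ∀ (zh : ι → ℝ) (c : ι),
      ∑ x, (zh + Pi.single c (1:ℝ) : ι → ℝ) x • g x = ∑ x, zh x • g x + g c := by
    intro zh c
    simp [add_smul, Finset.sum_add_distrib, Pi.single_apply, ite_smul]
  induction k with
  | zero =>
    intro S hS
    have : S = ∅ := by simpa using hS
    subst this
    exact ⟨0, by simp [IsKSparse], by simp⟩
  | succ k ih =>
    intro S hS
    rcases S.eq_empty_or_nonempty with rfl | ⟨i, hi⟩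
    · exact ⟨0, by simp [IsKSparse], by simp⟩
    have hc := Finset.card_erase_of_mem hi
    rcases (S.erase i).eq_empty_or_nonempty with he | ⟨j, hj⟩
    · obtain ⟨c, hgc⟩ := h1 i
      obtain ⟨zh, a, b⟩ := ih ∅ (by simp)
      refine ⟨zh + Pi.single c 1, step _ _ _ a, ?_⟩
      rw [stepsum, b, hgc, ← Finset.sum_erase_add S h hi, he]
    · have hc2 := Finset.card_erase_of_mem hj
      obtain ⟨c, hgc⟩ := h2 j i
      obtain ⟨zh, a, b⟩ := ih ((S.erase i).erase j) (by omega)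
      refine ⟨zh + Pi.single c 1, step _ _ _ a, ?_⟩
      rw [stepsum, b, hgc, ← Finset.sum_erase_add S h hi, ← Finset.sum_erase_add _ h hj, add_assoc]

theorem aux_mulVec {ι κ : Type*} [Fintype ι] (g : ι → κ → ℝ) (x : ι → ℝ) :
    (Matrix.of fun a c => g c a).mulVec x = ∑ c, x c • g c := by
  ext a
  simp [Matrix.mulVec, dotProduct, Finset.sum_apply, mul_comm]

set_option maxHeartbeats 1000000 in
/-- **ε-net dictionary construction**: there is a dictionary `B` with
`O(p² (1 + ρ/η)²)` columns such that every bounded `2k`-sparse combination `A z` is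
`k·η`-approximated by a `k`-sparse combination of the columns of `B`. -/
theorem net_dictionary_exists :
    ∃ C : ℝ, 0 < C ∧
      ∀ (d p k : ℕ) (δ ρ η : ℝ) (A : Matrix (Fin d) (Fin p) ℝ),
        0 < k → δ ≤ 1 / 2 → SatisfiesRIP A (2 * k) δ →
        0 < ρ → 0 < η → η ≤ ρ →
        ∃ (q : ℕ) (B : Matrix (Fin d) (Fin q) ℝ),
          (q : ℝ) ≤ C * (p : ℝ) ^ 2 * (1 + ρ / η) ^ 2 ∧
          ∀ z : Fin p → ℝ, IsKSparse (2 * k) z →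
            Real.sqrt (sqNorm (A.mulVec z)) ≤ ρ →
            ∃ zh : Fin q → ℝ, IsKSparse k zh ∧
              Real.sqrt (sqNorm (A.mulVec z - B.mulVec zh)) ≤ (k : ℝ) * η := by
  classical
  refine ⟨25, by norm_num, ?_⟩
  intro d p k δ ρ η A hk hδ hA hρ hη hηρ
  set r := ρ / η with hr
  have hr0 : 0 < r := by positivity
  set N : ℕ := ⌈2 * r⌉₊ + 1 with hN
  have hN1 : 2 * r + 1 ≤ (N : ℝ) := by
    have := Nat.le_ceil (2 * r)
    push_cast [hN]; linarith
  have hN2 : (N : ℝ) ≤ 2 * r + 2 := by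
    have := (Nat.ceil_lt_add_one (show 0 ≤ 2 * r by positivity)).le
    push_cast [hN]; linarith
  let M := {m : ℤ // m ∈ Finset.Icc (-(N : ℤ)) N}
  let I := Fin p × Fin p × M × M
  have hcard : Fintype.card I = p * (p * ((2 * N + 1) * (2 * N + 1))) := by
    have : Fintype.card M = 2 * N + 1 := by
      simp only [M, Fintype.card_coe, Int.card_Icc]
      omega
    simp only [I, Fintype.card_prod, Fintype.card_fin, this]
  let e := Fintype.equivFin I
  let col : Fin p → Fin d → ℝ := fun i a => A a i
  let f : I → Fin d → ℝ := fun x =>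
    (η * (x.2.2.1.1 : ℝ)) • col x.1 + (η * (x.2.2.2.1 : ℝ)) • col x.2.1
  let g : Fin (Fintype.card I) → Fin d → ℝ := fun c => f (e.symm c)
  refine ⟨Fintype.card I, Matrix.of fun a c => g c a, ?_, ?_⟩
  · rw [hcard]
    push_cast
    have h5 : 2 * (N : ℝ) + 1 ≤ 5 * (1 + r) := by linarith
    have h6 : (2 * (N : ℝ) + 1) ^ 2 ≤ (5 * (1 + r)) ^ 2 := by gcongr
    nlinarith [mul_le_mul_of_nonneg_left h6 (sq_nonneg (p : ℝ))]
  · intro z hz hAz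
    have hAz2 : sqNorm (A.mulVec z) ≤ ρ ^ 2 := (Real.sqrt_le_left hρ.le).1 hAz
    have hzn : sqNorm z ≤ 2 * ρ ^ 2 := by
      have h0 : 0 ≤ sqNorm z := Finset.sum_nonneg fun i _ => sq_nonneg _
      nlinarith [(hA z hz).1]
    have hzi : ∀ i, |z i| ≤ 2 * ρ := by
      intro i
      have : (z i) ^ 2 ≤ sqNorm z :=
        Finset.single_le_sum (f := fun i => (z i) ^ 2) (fun i _ => sq_nonneg _) (Finset.mem_univ i)
      have h4 : (z i) ^ 2 ≤ (2 * ρ) ^ 2 := by nlinarith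
      exact abs_le_of_sq_le_sq h4 (by positivity)
    let w : Fin p → ℤ := fun i => round (z i / η)
    have hwr : ∀ i, |z i / η - w i| ≤ 1 / 2 := fun i => abs_sub_round _
    have hw : ∀ i, w i ∈ Finset.Icc (-(N : ℤ)) N := by
      intro i
      have h1 := abs_le.1 (hwr i)
      have h2 : |z i / η| ≤ 2 * r := by
        rw [abs_div, abs_of_pos hη, hr, ← mul_div_assoc]
        exact div_le_div_of_nonneg_right (hzi i) hη.le
      have h3 := abs_le.1 h2
      rw [Finset.mem_Icc]
      constructor
      · have : (-(N : ℝ)) ≤ w i := by linarith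
        exact_mod_cast this
      · have : (w i : ℝ) ≤ N := by linarith
        exact_mod_cast this
    have h0M : (0 : ℤ) ∈ Finset.Icc (-(N : ℤ)) N := by simp
    obtain ⟨zh, hs, hsum⟩ := aux_pair g (fun i => (η * (w i : ℝ)) • col i)
      (fun i => ⟨e (i, i, ⟨w i, hw i⟩, ⟨0, h0M⟩), by simp [g, f]⟩)
      (fun i j => ⟨e (i, j, ⟨w i, hw i⟩, ⟨w j, hw j⟩), by simp [g, f]⟩) k
      (Finset.univ.filter fun i => z i ≠ 0) hz
    refine ⟨zh, hs, ?_⟩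
    let u : Fin p → ℝ := fun i => z i - η * w i
    have hw0 : ∀ i, z i = 0 → w i = 0 := fun i hi => by simp [w, hi]
    have hu0 : ∀ i, z i = 0 → u i = 0 := fun i hi => by simp [u, hi, hw0 i hi]
    have hB : (Matrix.of fun a c => g c a).mulVec zh = A.mulVec (fun i => η * w i) := by
      rw [aux_mulVec, hsum, Finset.sum_filter_of_ne]
      · exact (aux_mulVec col (fun i => η * (w i : ℝ))).symm
      · intro i _ hne hi
        apply hne
        simp [hw0 i hi]
    have hE : A.mulVec z - (Matrix.of fun a c => g c a).mulVec zh = A.mulVec u := by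
      rw [hB, ← Matrix.mulVec_sub]; rfl
    have hus : IsKSparse (2 * k) u := by
      refine le_trans (Finset.card_le_card ?_) hz
      intro i hi
      simp only [Finset.mem_filter, Finset.mem_univ, true_and] at hi ⊢
      exact fun h => hi (hu0 i h)
    have hui : ∀ i, (u i) ^ 2 ≤ η ^ 2 / 4 := by
      intro i
      have h1 : u i = η * (z i / η - w i) := by simp only [u]; field_simp
      have h2 : (z i / η - w i) ^ 2 ≤ (1 / 2) ^ 2 := sq_le_sq.2 (by
        rw [abs_of_pos (show (0:ℝ) < 1 / 2 by norm_num)]; exact hwr i)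
      rw [h1, mul_pow]
      nlinarith [mul_le_mul_of_nonneg_left h2 (sq_nonneg η)]
    have hun : sqNorm u ≤ 2 * k * (η ^ 2 / 4) := by
      have e2 : sqNorm u = ∑ i ∈ Finset.univ.filter (fun i => z i ≠ 0), (u i) ^ 2 := by
        unfold sqNorm
        rw [Finset.sum_filter_of_ne]
        intro i _ hne hi
        exact hne (by simp [hu0 i hi])
      rw [e2]
      refine (Finset.sum_le_card_nsmul _ _ _ fun i _ => hui i).trans ?_
      rw [nsmul_eq_mul]
      refine mul_le_mul_of_nonneg_right ?_ (by positivity)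
      exact_mod_cast hz
    have hu_nn : 0 ≤ sqNorm u := Finset.sum_nonneg fun i _ => sq_nonneg _
    have hk1 : (1 : ℝ) ≤ k := by exact_mod_cast hk
    rw [hE]
    apply Real.sqrt_le_iff.2 ⟨by positivity, ?_⟩
    have h7 : sqNorm (A.mulVec u) ≤ 3 / 2 * sqNorm u := by
      nlinarith [(hA u hus).2]
    have h8 : (k : ℝ) * η ^ 2 ≤ k * (k * η ^ 2) := by
      have : 0 ≤ (k : ℝ) * η ^ 2 := by positivity
      nlinarith
    have h9 : 0 ≤ (k : ℝ) * η ^ 2 := by positivity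
    nlinarith

end
end

section
/- Let Λ ∈ ℝ^{m×p} have unit-norm columns and be μ-incoherent, let S ⊆ [p] with |S| = s ≥ 1 and (s−1)μ < 1. Then Λ_S has full column rank and for every v ∈ ℝ^m, ‖Λ_S^+ v‖² ≤ (s/(1 − (s−1)μ)²) · max_{i ∈ S} ⟨Λ_i, v⟩², where Λ_S^+ = (Λ_S^T Λ_S)^{−1} Λ_S^T. -/
noncomputable section

/-- Submatrix of the columns of `Λ` indexed by `S`. -/
def subCols {m p : ℕ} (Λ : Matrix (Fin m) (Fin p) ℝ) (S : Finset (Fin p)) :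
    Matrix (Fin m) {j // j ∈ S} ℝ :=
  Matrix.of fun i j => Λ i j.1

lemma key_bound {ι : Type*} [Fintype ι] [DecidableEq ι] [Nonempty ι] (G : Matrix ι ι ℝ) (μ : ℝ)
    (hd : ∀ i, G i i = 1) (ho : ∀ i j, i ≠ j → |G i j| ≤ μ) (w : ι → ℝ) :
    ∃ k, (∀ j, |w j| ≤ |w k|) ∧
      |w k| * (1 - ((Fintype.card ι : ℝ) - 1) * μ) ≤ |G.mulVec w k| := by
  obtain ⟨k, hk⟩ := Finite.exists_max (fun j => |w j|)
  refine ⟨k, hk, ?_⟩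
  have h1 : G.mulVec w k = w k + ∑ j ∈ Finset.univ.erase k, G k j * w j := by
    have h := Finset.add_sum_erase Finset.univ (fun j => G k j * w j) (Finset.mem_univ k)
    simp only [hd, one_mul] at h
    rw [h]; rfl
  have h2 : |∑ j ∈ Finset.univ.erase k, G k j * w j| ≤
      ((Fintype.card ι : ℝ) - 1) * (μ * |w k|) := by
    refine (Finset.abs_sum_le_sum_abs _ _).trans ?_
    have h3 : ∀ j ∈ Finset.univ.erase k, |G k j * w j| ≤ μ * |w k| := by
      intro j hj
      have hne : k ≠ j := (Finset.ne_of_mem_erase hj).symm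
      rw [abs_mul]
      exact mul_le_mul (ho k j hne) (hk j) (abs_nonneg _) ((abs_nonneg _).trans (ho k j hne))
    have h4 := Finset.sum_le_card_nsmul _ _ _ h3
    rw [Finset.card_erase_of_mem (Finset.mem_univ k), Finset.card_univ, nsmul_eq_mul,
      Nat.cast_sub Fintype.card_pos, Nat.cast_one] at h4
    exact h4
  have h5 : |w k| ≤ |G.mulVec w k| + |∑ j ∈ Finset.univ.erase k, G k j * w j| := by
    have h6 : w k = G.mulVec w k - ∑ j ∈ Finset.univ.erase k, G k j * w j := by rw [h1]; ring
    calc |w k| = |G.mulVec w k - ∑ j ∈ Finset.univ.erase k, G k j * w j| := by rw [← h6]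
      _ ≤ _ := abs_sub _ _
  nlinarith

/-- For a `μ`-incoherent matrix `Λ` with unit-norm columns and `|S| = s` with
`(s-1)μ < 1`, the submatrix `Λ_S` has full column rank and
`‖Λ_S⁺ v‖² ≤ (s / (1 - (s-1)μ)²) · max_{i ∈ S} ⟨Λ_i, v⟩²`. -/
theorem incoherent_pinv_bound (m p : ℕ) (μ : ℝ) (hμ0 : 0 ≤ μ)
    (Λ : Matrix (Fin m) (Fin p) ℝ)
    (hcols : ∀ j, sqNorm (fun i => Λ i j) = 1)
    (hinc : ∀ i j, i ≠ j → |∑ r, Λ r i * Λ r j| ≤ μ)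
    (S : Finset (Fin p)) (s : ℕ) (hcard : S.card = s) (hs : 1 ≤ s)
    (hμ : ((s : ℝ) - 1) * μ < 1) :
    Function.Injective (subCols Λ S).mulVec ∧
    ∀ v : Fin m → ℝ,
      sqNorm (((((subCols Λ S).transpose * subCols Λ S)⁻¹ *
          (subCols Λ S).transpose).mulVec v)) ≤
        ((s : ℝ) / (1 - ((s : ℝ) - 1) * μ) ^ 2) *
          ⨆ i : {j // j ∈ S}, (∑ r, Λ r i.1 * v r) ^ 2 := by
  have hne : Nonempty {j // j ∈ S} := by
    have : 0 < S.card := by omega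
    obtain ⟨x, hx⟩ := Finset.card_pos.mp this
    exact ⟨⟨x, hx⟩⟩
  have hc : (Fintype.card {j // j ∈ S} : ℝ) = s := by
    rw [Fintype.card_coe, hcard]
  set A := subCols Λ S with hA
  set G := A.transpose * A with hG
  have hpos : 0 < 1 - ((s : ℝ) - 1) * μ := by linarith
  have key := key_bound G μ
    (by
      intro i
      have h := hcols i.1
      simp only [sqNorm, pow_two] at h
      simpa [hG, hA, subCols, Matrix.mul_apply] using h)
    (by
      intro i j hij
      have h := hinc i.1 j.1 (fun h => hij (Subtype.ext h))
      simpa [hG, hA, subCols, Matrix.mul_apply] using h)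
  rw [hc] at key
  have hzero : ∀ w, G.mulVec w = 0 → w = 0 := by
    intro w hw
    obtain ⟨k, hk, hb⟩ := key w
    rw [hw] at hb
    simp only [Pi.zero_apply, abs_zero] at hb
    have : |w k| ≤ 0 := by
      by_contra hcon
      push Not at hcon
      have := mul_pos hcon hpos
      linarith
    funext j
    exact abs_nonpos_iff.mp ((hk j).trans this)
  have hGinj : Function.Injective G.mulVec := by
    intro x y hxy
    refine sub_eq_zero.mp (hzero _ ?_)
    rw [Matrix.mulVec_sub]
    exact sub_eq_zero.mpr hxy
  have hunit : IsUnit G.det :=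
    (Matrix.isUnit_iff_isUnit_det G).mp (Matrix.mulVec_injective_iff_isUnit.mp hGinj)
  refine ⟨?_, ?_⟩
  · intro x y hxy
    apply hGinj
    simp only [hG, ← Matrix.mulVec_mulVec, hxy]
  intro v
  set w := (G⁻¹ * A.transpose).mulVec v with hw
  have hGw : G.mulVec w = A.transpose.mulVec v := by
    rw [hw, Matrix.mulVec_mulVec, ← Matrix.mul_assoc, Matrix.mul_nonsing_inv _ hunit,
      Matrix.one_mul]
  obtain ⟨k, hk, hb⟩ := key w
  have hck : G.mulVec w k = ∑ r, Λ r k.1 * v r := by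
    rw [hGw]; rfl
  rw [hck] at hb
  have hsup : (∑ r, Λ r k.1 * v r) ^ 2 ≤ ⨆ i : {j // j ∈ S}, (∑ r, Λ r i.1 * v r) ^ 2 :=
    le_ciSup (f := fun i : {j // j ∈ S} => (∑ r, Λ r i.1 * v r) ^ 2)
      (Set.finite_range _).bddAbove k
  have hsq : (w k) ^ 2 * (1 - ((s : ℝ) - 1) * μ) ^ 2 ≤ (∑ r, Λ r k.1 * v r) ^ 2 := by
    have := pow_le_pow_left₀ (mul_nonneg (abs_nonneg _) hpos.le) hb 2
    rwa [mul_pow, sq_abs, sq_abs] at this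
  have hsum : sqNorm w ≤ s * (w k) ^ 2 := by
    have h := Finset.sum_le_card_nsmul Finset.univ (fun j => (w j) ^ 2) ((w k) ^ 2)
      (fun j _ => sq_le_sq.mpr (hk j))
    rw [nsmul_eq_mul, Finset.card_univ, hc] at h
    exact h
  refine hsum.trans ?_
  rw [div_mul_eq_mul_div, mul_div_assoc]
  refine mul_le_mul_of_nonneg_left ?_ (Nat.cast_nonneg _)
  rw [le_div_iff₀ (pow_pos hpos 2)]
  exact hsq.trans hsup

end
end

section
/- Let Λ ∈ ℝ^{m×p} have unit-norm columns and be μ-incoherent, let k be a positive integer with (k−1)μ < 1, and let S, T ⊆ [p] be disjoint subsets with |S| ≤ k and |T| ≤ k. Then for every x ∈ ℝ^{|T|}, ‖Λ_S^+ Λ_T x‖ ≤ (k·μ/(1 − (k−1)μ)) · ‖x‖, where Λ_S^+ = (Λ_S^T Λ_S)^{−1} Λ_S^T. -/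
noncomputable section

lemma sum_abs_sq_le {ι : Type*} [Fintype ι] (k : ℕ) (h : Fintype.card ι ≤ k) (v : ι → ℝ) :
    (∑ i, |v i|) ^ 2 ≤ k * sqNorm v := by
  have h1 := sq_sum_le_card_mul_sum_sq (s := (Finset.univ : Finset ι)) (f := fun i => |v i|)
  simp only [sq_abs, Finset.card_univ] at h1
  refine h1.trans ?_
  unfold sqNorm
  have : (Fintype.card ι : ℝ) ≤ k := by exact_mod_cast h
  have h0 : 0 ≤ ∑ i, (v i) ^ 2 := Finset.sum_nonneg fun i _ => sq_nonneg _
  exact mul_le_mul_of_nonneg_right this h0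

lemma sqNorm_nn {ι : Type*} [Fintype ι] (v : ι → ℝ) : 0 ≤ sqNorm v :=
  Finset.sum_nonneg fun i _ => sq_nonneg _

lemma cross_le {ι κ : Type*} [Fintype ι] [Fintype κ] (k : ℕ)
    (hi : Fintype.card ι ≤ k) (hj : Fintype.card κ ≤ k) (μ : ℝ) (hμ0 : 0 ≤ μ)
    (B : Matrix ι κ ℝ) (hB : ∀ i j, |B i j| ≤ μ) (y : ι → ℝ) (x : κ → ℝ) :
    y ⬝ᵥ B.mulVec x ≤ k * μ * (Real.sqrt (sqNorm y) * Real.sqrt (sqNorm x)) := by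
  have h1 : y ⬝ᵥ B.mulVec x ≤ μ * ((∑ i, |y i|) * ∑ j, |x j|) := by
    simp only [dotProduct, Matrix.mulVec, Finset.sum_mul_sum]
    simp only [Finset.mul_sum]
    refine Finset.sum_le_sum fun i _ => Finset.sum_le_sum fun j _ => ?_
    calc y i * (B i j * x j) ≤ |y i * (B i j * x j)| := le_abs_self _
      _ = |B i j| * (|y i| * |x j|) := by rw [abs_mul, abs_mul]; ring
      _ ≤ _ := mul_le_mul_of_nonneg_right (hB i j) (by positivity)
  have ha : ∑ i, |y i| ≤ Real.sqrt k * Real.sqrt (sqNorm y) := by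
    rw [← Real.sqrt_mul (by positivity)]
    exact Real.le_sqrt_of_sq_le (sum_abs_sq_le k hi y)
  have hb : ∑ i, |x i| ≤ Real.sqrt k * Real.sqrt (sqNorm x) := by
    rw [← Real.sqrt_mul (by positivity)]
    exact Real.le_sqrt_of_sq_le (sum_abs_sq_le k hj x)
  have hc := mul_le_mul ha hb (Finset.sum_nonneg fun i _ => abs_nonneg _) (by positivity)
  refine h1.trans ((mul_le_mul_of_nonneg_left hc hμ0).trans (le_of_eq ?_))
  have hk := Real.mul_self_sqrt (Nat.cast_nonneg (α := ℝ) k)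
  linear_combination μ * Real.sqrt (sqNorm y) * Real.sqrt (sqNorm x) * hk

lemma gram_ge {ι : Type*} [Fintype ι] [DecidableEq ι] (k : ℕ)
    (hi : Fintype.card ι ≤ k) (μ : ℝ) (hμ0 : 0 ≤ μ)
    (G : Matrix ι ι ℝ) (hd : ∀ i, G i i = 1) (hG : ∀ i j, i ≠ j → |G i j| ≤ μ) (y : ι → ℝ) :
    (1 - ((k : ℝ) - 1) * μ) * sqNorm y ≤ y ⬝ᵥ G.mulVec y := by
  have h1 : (1 + μ) * sqNorm y - μ * (∑ i, |y i|) ^ 2 ≤ y ⬝ᵥ G.mulVec y := by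
    have e : (1 + μ) * sqNorm y - μ * (∑ i, |y i|) ^ 2 =
        ∑ i, ∑ j, ((if i = j then (1 + μ) * (y i) ^ 2 else 0) - μ * (|y i| * |y j|)) := by
      rw [sq (∑ i, |y i|), Finset.sum_mul_sum]
      simp only [Finset.sum_sub_distrib, Finset.sum_ite_eq, Finset.mem_univ, if_true, sqNorm,
        Finset.mul_sum]
    rw [e]
    simp only [dotProduct, Matrix.mulVec, Finset.mul_sum]
    refine Finset.sum_le_sum fun i _ => Finset.sum_le_sum fun j _ => ?_
    by_cases h : i = j
    · subst h
      rw [if_pos rfl, hd, abs_mul_abs_self]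
      apply le_of_eq; ring
    · rw [if_neg h]
      have := mul_le_mul_of_nonneg_right (hG i j h) (by positivity : 0 ≤ |y i| * |y j|)
      have h2 : |y i * (G i j * y j)| = |G i j| * (|y i| * |y j|) := by
        rw [abs_mul, abs_mul]; ring
      have := neg_abs_le (y i * (G i j * y j))
      linarith
  have h2 := mul_le_mul_of_nonneg_left (sum_abs_sq_le k hi y) hμ0
  linarith

/-- For a `μ`-incoherent matrix `Λ` with unit-norm columns, disjoint supports
`S, T` of size at most `k` with `(k-1)μ < 1`, the cross-term operator is small:
`‖Λ_S⁺ Λ_T x‖ ≤ (kμ / (1 - (k-1)μ)) ‖x‖`. -/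
theorem incoherent_cross_term_bound (m p k : ℕ) (hk : 0 < k) (μ : ℝ) (hμ0 : 0 ≤ μ)
    (Λ : Matrix (Fin m) (Fin p) ℝ)
    (hcols : ∀ j, sqNorm (fun i => Λ i j) = 1)
    (hinc : ∀ i j, i ≠ j → |∑ r, Λ r i * Λ r j| ≤ μ)
    (hμ : ((k : ℝ) - 1) * μ < 1)
    (S T : Finset (Fin p)) (hST : Disjoint S T) (hS : S.card ≤ k) (hT : T.card ≤ k) :
    ∀ x : {j // j ∈ T} → ℝ,
      Real.sqrt (sqNorm (((((subCols Λ S).transpose * subCols Λ S)⁻¹ *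
          (subCols Λ S).transpose).mulVec ((subCols Λ T).mulVec x)))) ≤
        ((k : ℝ) * μ / (1 - ((k : ℝ) - 1) * μ)) * Real.sqrt (sqNorm x) := by
  intro x
  have hδ : 0 < 1 - ((k : ℝ) - 1) * μ := by linarith
  set G := (subCols Λ S).transpose * subCols Λ S with hGdef
  have hcS : Fintype.card {j // j ∈ S} ≤ k := by simpa using hS
  have hcT : Fintype.card {j // j ∈ T} ≤ k := by simpa using hT
  have hge := gram_ge k hcS μ hμ0 G
    (fun i => by
      have := hcols i.1
      simpa [hGdef, Matrix.mul_apply, subCols, sqNorm, sq] using this)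
    (fun i j hij => by
      have := hinc i.1 j.1 (fun h => hij (Subtype.ext h))
      simpa [hGdef, Matrix.mul_apply, subCols] using this)
  have hunit : IsUnit G := by
    rw [← Matrix.mulVec_injective_iff_isUnit]
    intro a b hab
    have h0 : G.mulVec (a - b) = 0 := by
      rw [Matrix.mulVec_sub]; exact sub_eq_zero.2 hab
    have h1 := hge (a - b)
    rw [h0, dotProduct_zero] at h1
    have h2 : sqNorm (a - b) = 0 :=
      le_antisymm (by by_contra hc; push Not at hc; nlinarith) (sqNorm_nn _)
    unfold sqNorm at h2
    rw [Finset.sum_eq_zero_iff_of_nonneg (fun i _ => sq_nonneg _)] at h2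
    funext i
    have := h2 i (Finset.mem_univ _)
    exact sub_eq_zero.1 (pow_eq_zero_iff (two_ne_zero) |>.1 this)
  set y := (G⁻¹ * (subCols Λ S).transpose).mulVec ((subCols Λ T).mulVec x) with hy
  have hGy : G.mulVec y = ((subCols Λ S).transpose * subCols Λ T).mulVec x := by
    rw [hy, Matrix.mulVec_mulVec, ← Matrix.mul_assoc,
      Matrix.mul_nonsing_inv _ ((Matrix.isUnit_iff_isUnit_det _).1 hunit), Matrix.one_mul,
      Matrix.mulVec_mulVec]
  have h1 := hge y
  rw [hGy] at h1
  have h2 := cross_le k hcS hcT μ hμ0 ((subCols Λ S).transpose * subCols Λ T)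
    (fun i j => by
      have := hinc i.1 j.1 (fun h => Finset.disjoint_left.1 hST i.2 (h ▸ j.2))
      simpa [Matrix.mul_apply, subCols] using this) y x
  have h3 := h1.trans h2
  have hs := Real.mul_self_sqrt (sqNorm_nn y)
  rw [div_mul_eq_mul_div, le_div_iff₀ hδ]
  rcases (Real.sqrt_nonneg (sqNorm y)).eq_or_lt with h | h
  · rw [← h, zero_mul]; positivity
  · refine le_of_mul_le_mul_left ?_ h
    have h4 : Real.sqrt (sqNorm y) * (Real.sqrt (sqNorm y) * (1 - ((k : ℝ) - 1) * μ)) =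
        (1 - ((k : ℝ) - 1) * μ) * sqNorm y := by
      linear_combination (1 - ((k : ℝ) - 1) * μ) * hs
    linarith

end
end
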